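/- Let 𝒰, 𝒱, 𝒰̂ be finite types, d: 𝒰 × 𝒰̂ → ℝ≥0 a distortion measure, N a positive integer, and let (U_1,V_1),…,(U_N,V_N) be i.i.d. random pairs in 𝒰 × 𝒱. Let K be a finite-valued random variable independent of (U^N, V^N), and let Y be a finite-valued random variable that is conditionally independent of V^N given (U^N, K). Suppose g is a function mapping (Y, V^N, K) to 𝒰̂^N, with components Û_i = g(Y,V^N,K)_i, satisfying (1/N)·∑_{i=1}^N E[d(U_i, Û_i)] ≤ D. Then I(U^N; Y | (K, V^N)) ≥ N·R_{U|V}(D), where R_{U|V} is the Wyner–Ziv rate–distortion function of the pair (U_1, V_1). -/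

import Mathlib

open scoped BigOperators

/-- The probability that a random variable `X` on the finite probability space `(Ω, μ)`
takes the value `a`. -/
noncomputable def prob {Ω α : Type} [Fintype Ω] [DecidableEq α]
    (μ : Ω → ℝ) (X : Ω → α) (a : α) : ℝ :=
  ∑ ω, if X ω = a then μ ω else 0

/-- Shannon entropy (natural logarithm) of `X`. -/
noncomputable def entH {Ω α : Type} [Fintype Ω] [Fintype α] [DecidableEq α]
    (μ : Ω → ℝ) (X : Ω → α) : ℝ :=
  -∑ a, prob μ X a * Real.log (prob μ X a)

/-- Conditional entropy `H(X|Y) = H(X,Y) - H(Y)`. -/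
noncomputable def condH {Ω α β : Type} [Fintype Ω] [Fintype α] [DecidableEq α]
    [Fintype β] [DecidableEq β] (μ : Ω → ℝ) (X : Ω → α) (Y : Ω → β) : ℝ :=
  entH μ (fun ω => (X ω, Y ω)) - entH μ Y

/-- Mutual information `I(X;Y) = H(X) + H(Y) - H(X,Y)`. -/
noncomputable def MI {Ω α β : Type} [Fintype Ω] [Fintype α] [DecidableEq α]
    [Fintype β] [DecidableEq β] (μ : Ω → ℝ) (X : Ω → α) (Y : Ω → β) : ℝ :=
  entH μ X + entH μ Y - entH μ (fun ω => (X ω, Y ω))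

/-- Conditional mutual information
`I(X;Y|Z) = H(X,Z) + H(Y,Z) - H(X,Y,Z) - H(Z)`. -/
noncomputable def condMI {Ω α β γ : Type} [Fintype Ω] [Fintype α] [DecidableEq α]
    [Fintype β] [DecidableEq β] [Fintype γ] [DecidableEq γ]
    (μ : Ω → ℝ) (X : Ω → α) (Y : Ω → β) (Z : Ω → γ) : ℝ :=
  entH μ (fun ω => (X ω, Z ω)) + entH μ (fun ω => (Y ω, Z ω))
    - entH μ (fun ω => (X ω, Y ω, Z ω)) - entH μ Z

/-- `A` is conditionally independent of `B` given `C`: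
`P(A=a, B=b | C=c) = P(A=a|C=c)·P(B=b|C=c)` whenever `P(C=c) > 0`
(stated multiplicatively). -/
def CondIndep {Ω α β γ : Type} [Fintype Ω] [DecidableEq α] [DecidableEq β] [DecidableEq γ]
    (μ : Ω → ℝ) (A : Ω → α) (B : Ω → β) (C : Ω → γ) : Prop :=
  ∀ a b c, 0 < prob μ C c →
    prob μ (fun ω => (A ω, B ω, C ω)) (a, b, c) * prob μ C c =
      prob μ (fun ω => (A ω, C ω)) (a, c) * prob μ (fun ω => (B ω, C ω)) (b, c)

/-- Mutual information of a joint probability mass function `P` on `α × β`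
(natural logarithm, with `0·log 0 = 0`). -/
noncomputable def miJoint {α β : Type} [Fintype α] [Fintype β] (P : α → β → ℝ) : ℝ :=
  ∑ x, ∑ y, P x y * Real.log (P x y / ((∑ y', P x y') * (∑ x', P x' y)))

/-- The constraint set of the Wyner--Ziv rate--distortion function of a pair `(U,V)`
with joint law `qUV`, reproduction alphabet `𝒰h` and distortion measure `d`, at
distortion level `D`: values `I(U;A) − I(V;A)` over joint laws `q` of `(A,U,V)` with
`A` in an auxiliary alphabet of `|𝒰|+1` elements, `(U,V)`-marginal `qUV`, `A`
conditionally independent of `V` given `U`, admitting `ψ` with `E[d(U,ψ(A,V))] ≤ D`. -/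
def WZset {𝒰 𝒱 𝒰h : Type} [Fintype 𝒰] [Fintype 𝒱] [Fintype 𝒰h]
    (qUV : 𝒰 × 𝒱 → ℝ) (d : 𝒰 → 𝒰h → ℝ) (D : ℝ) : Set ℝ :=
  {ρ | ∃ q : Fin (Fintype.card 𝒰 + 1) × 𝒰 × 𝒱 → ℝ,
    (∀ z, 0 ≤ q z) ∧ (∑ z, q z = 1) ∧
    (∀ u v, (∑ a, q (a, u, v)) = qUV (u, v)) ∧
    (∀ a u v, 0 < (∑ a', ∑ v', q (a', u, v')) →
      q (a, u, v) * (∑ a', ∑ v', q (a', u, v')) =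
        (∑ v', q (a, u, v')) * (∑ a', q (a', u, v))) ∧
    (∃ ψ : Fin (Fintype.card 𝒰 + 1) → 𝒱 → 𝒰h,
      (∑ a, ∑ u, ∑ v, q (a, u, v) * d u (ψ a v)) ≤ D) ∧
    ρ = miJoint (fun (u : 𝒰) (a : Fin (Fintype.card 𝒰 + 1)) => ∑ v, q (a, u, v))
        - miJoint (fun (v : 𝒱) (a : Fin (Fintype.card 𝒰 + 1)) => ∑ u, q (a, u, v))}

/-- The Wyner--Ziv rate--distortion function `R_{U|V}(D)`. -/
noncomputable def WZ {𝒰 𝒱 𝒰h : Type} [Fintype 𝒰] [Fintype 𝒱] [Fintype 𝒰h]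
    (qUV : 𝒰 × 𝒱 → ℝ) (d : 𝒰 → 𝒰h → ℝ) (D : ℝ) : ℝ :=
  sInf (WZset qUV d D)

set_option synthInstance.maxSize 1000

namespace WZaux

section basic
variable {Ω α β : Type} [Fintype Ω] [Fintype α] [DecidableEq α] [DecidableEq β]

theorem expect_eq (μ : Ω → ℝ) (X : Ω → α) (f : α → ℝ) :
    ∑ ω, μ ω * f (X ω) = ∑ a, prob μ X a * f a := by
  unfold prob
  simp_rw [Finset.sum_mul]
  rw [Finset.sum_comm]
  refine Finset.sum_congr rfl fun ω _ => ?_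
  simp [ite_mul]

theorem prob_comp (μ : Ω → ℝ) (X : Ω → α) (f : α → β) (b : β) :
    prob μ (fun ω => f (X ω)) b = ∑ a, if f a = b then prob μ X a else 0 := by
  have := expect_eq μ X (fun a => if f a = b then 1 else 0)
  simpa [prob] using this

theorem prob_nonneg {μ : Ω → ℝ} (h : ∀ ω, 0 ≤ μ ω) (X : Ω → β) (b : β) : 0 ≤ prob μ X b := by
  unfold prob
  exact Finset.sum_nonneg fun ω _ => by split_ifs <;> simp [h]

theorem prob_pos {μ : Ω → ℝ} (h : ∀ ω, 0 ≤ μ ω) (X : Ω → β) (ω : Ω) (hω : 0 < μ ω) :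
    0 < prob μ X (X ω) := by
  unfold prob
  refine Finset.sum_pos' (fun ω _ => by split_ifs <;> simp [h]) ⟨ω, Finset.mem_univ _, by simpa⟩

theorem sum_prob (μ : Ω → ℝ) (X : Ω → α) : ∑ a, prob μ X a = ∑ ω, μ ω := by
  have := expect_eq μ X (fun _ => 1)
  simpa using this.symm

theorem entH_eq (μ : Ω → ℝ) (X : Ω → α) :
    entH μ X = -∑ ω, μ ω * Real.log (prob μ X (X ω)) := by
  unfold entH
  rw [expect_eq μ X (fun a => Real.log (prob μ X a))]

theorem entH_eq' (μ : Ω → ℝ) (X : Ω → α) :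
    entH μ X = ∑ a, Real.negMulLog (prob μ X a) := by
  unfold entH Real.negMulLog
  simp

theorem gibbs {μ : Ω → ℝ} (h : ∀ ω, 0 ≤ μ ω) (h1 : ∑ ω, μ ω = 1) (X : Ω → α) (r : α → ℝ)
    (hr : ∀ a, 0 ≤ r a) (hr1 : ∑ a, r a ≤ 1) (hp : ∀ ω, 0 < μ ω → 0 < r (X ω)) :
    ∑ ω, μ ω * Real.log (r (X ω)) ≤ ∑ ω, μ ω * Real.log (prob μ X (X ω)) := by
  have key : ∀ ω, μ ω * Real.log (r (X ω)) - μ ω * Real.log (prob μ X (X ω)) ≤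
      μ ω * (r (X ω) / prob μ X (X ω)) - μ ω := by
    intro ω
    rcases (h ω).eq_or_lt with h0 | h0
    · simp [← h0]
    · have a1 := hp ω h0
      have a2 := prob_pos h X ω h0
      rw [← mul_sub, ← Real.log_div a1.ne' a2.ne']
      have := Real.log_le_sub_one_of_pos (div_pos a1 a2)
      nlinarith
  have s := Finset.sum_le_sum fun ω (_ : ω ∈ Finset.univ) => key ω
  rw [Finset.sum_sub_distrib, Finset.sum_sub_distrib, h1,
    expect_eq μ X (fun a => r a / prob μ X a)] at s
  have : ∑ a, prob μ X a * (r a / prob μ X a) ≤ ∑ a, r a := by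
    refine Finset.sum_le_sum fun a _ => ?_
    by_cases h0 : prob μ X a = 0
    · simp [h0, hr]
    · rw [mul_div_cancel₀ _ h0]
  linarith

end basic

theorem lp_step {ι κ : Type} [Fintype ι] [Fintype κ] (b : ι → κ → ℝ) (c : ι → ℝ) (m : κ → ℝ)
    (t : ι → ℝ) (ht : ∀ i, 0 ≤ t i) (hm : ∀ i, t i ≠ 0 → 0 < ∑ k, m k * b i k)
    (hc : Fintype.card κ < (Finset.univ.filter fun i => t i ≠ 0).card) :
    ∃ t' : ι → ℝ, (∀ i, 0 ≤ t' i) ∧ (∀ i, t' i ≠ 0 → t i ≠ 0) ∧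
      (∃ i, t i ≠ 0 ∧ t' i = 0) ∧
      (∀ k, ∑ i, t' i * b i k = ∑ i, t i * b i k) ∧ ∑ i, t' i * c i ≤ ∑ i, t i * c i := by
  classical
  have hdep : ∃ s : ι → ℝ, (∀ i, t i = 0 → s i = 0) ∧ (∀ k, ∑ i, s i * b i k = 0) ∧
      ∃ i, s i ≠ 0 := by
    have hl : ¬ LinearIndependent ℝ (fun i : {i // t i ≠ 0} => b i.1) := by
      intro hli
      have := hli.fintype_card_le_finrank
      rw [Module.finrank_fintype_fun_eq_card, Fintype.card_subtype] at this
      omega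
    rw [Fintype.not_linearIndependent_iff] at hl
    obtain ⟨g, hg, i0, hi0⟩ := hl
    refine ⟨fun i => if h : t i ≠ 0 then g ⟨i, h⟩ else 0, ?_, ?_, ⟨i0.1, ?_⟩⟩
    · intro i hi; simp [hi]
    · intro k
      have := congrFun hg k
      simp only [Finset.sum_apply, Pi.smul_apply, smul_eq_mul, Pi.zero_apply] at this
      refine Eq.trans ?_ this
      symm
      apply Finset.sum_bij_ne_zero (fun i _ _ => i.1)
      · simp
      · intro a _ _ b _ _ h; exact Subtype.ext h
      · intro i _ hi
        have h : t i ≠ 0 := by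
          intro h; simp [h] at hi
        refine ⟨⟨i, h⟩, by simp, ?_, rfl⟩
        simpa [h] using hi
      · intro i _ _
        simp [i.2]
    · simpa [i0.2] using hi0
  obtain ⟨s, hs0, hsb, i1, hi1⟩ := hdep
  wlog hsc : ∑ i, s i * c i ≤ 0 generalizing s
  · refine this (fun i => - s i) (fun i hi => by simp [hs0 i hi]) (fun k => by simp [hsb k]) (by simpa using hi1) ?_
    simp only [neg_mul, Finset.sum_neg_distrib]
    linarith
  -- there is a negative entry
  have hneg : ∃ i, s i < 0 := by
    by_contra! hcon
    have h0 : ∑ i, s i * ∑ k, m k * b i k = 0 := by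
      simp_rw [Finset.mul_sum]
      rw [Finset.sum_comm]
      refine Finset.sum_eq_zero fun k _ => ?_
      have : ∑ i, s i * (m k * b i k) = m k * ∑ i, s i * b i k := by
        rw [Finset.mul_sum]; exact Finset.sum_congr rfl fun i _ => by ring
      rw [this, hsb, mul_zero]
    have hpos : 0 < ∑ i, s i * ∑ k, m k * b i k := by
      refine Finset.sum_pos' (fun i _ => ?_) ⟨i1, Finset.mem_univ _, ?_⟩
      · by_cases h : t i = 0
        · simp [hs0 i h]
        · exact mul_nonneg (hcon i) (hm i h).le
      · exact mul_pos (lt_of_le_of_ne (hcon i1) hi1.symm) (hm i1 fun h => hi1 (hs0 i1 h))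
    linarith
  obtain ⟨j, hj, hjmin⟩ := Finset.exists_min_image (Finset.univ.filter fun i => s i < 0)
    (fun i => t i / (- s i)) (by obtain ⟨i, hi⟩ := hneg; exact ⟨i, by simpa using hi⟩)
  simp only [Finset.mem_filter, Finset.mem_univ, true_and] at hj hjmin
  set l := t j / (- s j) with hl
  have hl0 : 0 ≤ l := div_nonneg (ht j) (by linarith)
  refine ⟨fun i => t i + l * s i, fun i => ?_, fun i hi h => ?_, ⟨j, fun h => ?_, ?_⟩, fun k => ?_, ?_⟩
  · by_cases hi : s i < 0
    · have := hjmin i hi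
      rw [le_div_iff₀ (by linarith)] at this
      linarith
    · have := mul_nonneg hl0 (not_lt.1 hi)
      have := ht i
      simp only; linarith
  · simp [h, hs0 i h] at hi
  · rw [hs0 j h] at hj; exact lt_irrefl _ hj
  · simp only [hl]; field_simp [hj.ne]; ring
  · simp_rw [add_mul, Finset.sum_add_distrib, mul_assoc, ← Finset.mul_sum, hsb]; simp
  · simp_rw [add_mul, Finset.sum_add_distrib, mul_assoc, ← Finset.mul_sum]
    nlinarith

theorem lp {ι κ : Type} [Fintype ι] [Fintype κ] (b : ι → κ → ℝ) (c : ι → ℝ) (m : κ → ℝ)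
    (n : ℕ) : ∀ (t : ι → ℝ), (∀ i, 0 ≤ t i) → (∀ i, t i ≠ 0 → 0 < ∑ k, m k * b i k) →
    (Finset.univ.filter fun i => t i ≠ 0).card ≤ n → 
    ∃ t' : ι → ℝ, (∀ i, 0 ≤ t' i) ∧ 
      (Finset.univ.filter fun i => t' i ≠ 0).card ≤ Fintype.card κ ∧
      (∀ k, ∑ i, t' i * b i k = ∑ i, t i * b i k) ∧ ∑ i, t' i * c i ≤ ∑ i, t i * c i := by
  classical
  induction n with
  | zero => 
    intro t ht _ hn
    exact ⟨t, ht, by omega, fun _ => rfl, le_rfl⟩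
  | succ n ih =>
    intro t ht hm hn
    by_cases hc : (Finset.univ.filter fun i => t i ≠ 0).card ≤ Fintype.card κ
    · exact ⟨t, ht, hc, fun _ => rfl, le_rfl⟩
    obtain ⟨t1, a1, a2, ⟨j, hj1, hj2⟩, a4, a5⟩ := lp_step b c m t ht hm (not_le.1 hc)
    have hlt : (Finset.univ.filter fun i => t1 i ≠ 0).card < (Finset.univ.filter fun i => t i ≠ 0).card := by
      apply Finset.card_lt_card
      rw [Finset.ssubset_iff_of_subset]
      · exact ⟨j, by simpa using hj1, by simpa using hj2⟩
      · intro i hi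
        simp only [Finset.mem_filter, Finset.mem_univ, true_and] at hi ⊢
        exact a2 i hi
    obtain ⟨t2, c1, c2, c3, c4⟩ := ih t1 a1 (fun i hi => hm i (a2 i hi)) (by omega)
    exact ⟨t2, c1, c2, fun k => (c3 k).trans (a4 k), c4.trans a5⟩

theorem reindex {ι : Type} [Fintype ι] [Nonempty ι] (t : ι → ℝ) (ht : ∀ i, 0 ≤ t i) (n : ℕ)
    (hn : (Finset.univ.filter fun i => t i ≠ 0).card ≤ n) :
    ∃ (a : Fin n → ι) (τ : Fin n → ℝ), (∀ j, 0 ≤ τ j) ∧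
      ∀ f : ι → ℝ, ∑ j, τ j * f (a j) = ∑ i, t i * f i := by
  classical
  have hn' : Fintype.card {i // t i ≠ 0} ≤ Fintype.card (Fin n) := by
    rw [Fintype.card_subtype]; simpa using hn
  obtain ⟨e⟩ := Function.Embedding.nonempty_of_card_le hn'
  let i0 : ι := Classical.arbitrary ι
  refine ⟨fun j => if h : ∃ i, e i = j then h.choose.1 else i0,
    fun j => if h : ∃ i, e i = j then t h.choose.1 else 0, fun j => ?_, fun f => ?_⟩
  · dsimp only; split_ifs
    · exact ht _
    · exact le_rfl
  · have h1 : ∑ i, t i * f i = ∑ i : {i // t i ≠ 0}, t i.1 * f i.1 := by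
      symm
      apply Finset.sum_bij_ne_zero (fun i _ _ => i.1)
      · simp
      · intro a _ _ b _ _ h; exact Subtype.ext h
      · intro i _ hi; exact ⟨⟨i, left_ne_zero_of_mul hi⟩, by simp, hi, rfl⟩
      · intros; rfl
    rw [h1]
    symm
    apply Finset.sum_bij_ne_zero (fun i _ _ => e i)
    · simp
    · intro a _ _ b _ _ h; exact e.injective h
    · intro j _ hj
      by_cases h : ∃ i, e i = j
      · simp only [h, dif_pos] at hj
        exact ⟨h.choose, Finset.mem_univ _, hj, h.choose_spec⟩
      · simp [h] at hj
    · intro i _ hi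
      have h : ∃ i', e i' = e i := ⟨i, rfl⟩
      have h2 : h.choose = i := e.injective h.choose_spec
      simp only [h, dif_pos, h2]

end WZaux

namespace WZaux

open Real in
theorem miJoint_eq {α β : Type} [Fintype α] [Fintype β] (P : α → β → ℝ) (hP : ∀ x y, 0 ≤ P x y) :
    miJoint P = ∑ x, negMulLog (∑ y, P x y) + ∑ y, negMulLog (∑ x, P x y)
      - ∑ x, ∑ y, negMulLog (P x y) := by
  have key : ∀ x y, P x y * log (P x y / ((∑ y', P x y') * (∑ x', P x' y))) =
      -(P x y * log (∑ y', P x y')) - P x y * log (∑ x', P x' y) - negMulLog (P x y) := by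
    intro x y
    by_cases h : P x y = 0
    · simp [h]
    have h1 : 0 < P x y := lt_of_le_of_ne (hP x y) (Ne.symm h)
    have h2 : 0 < ∑ y', P x y' :=
      lt_of_lt_of_le h1 (Finset.single_le_sum (fun y _ => hP x y) (Finset.mem_univ y))
    have h3 : 0 < ∑ x', P x' y :=
      lt_of_lt_of_le h1 (Finset.single_le_sum (f := fun x => P x y) (fun x _ => hP x y) (Finset.mem_univ x))
    rw [log_div h1.ne' (mul_pos h2 h3).ne', log_mul h2.ne' h3.ne', negMulLog]
    ring
  unfold miJoint
  simp_rw [key, Finset.sum_sub_distrib, Finset.sum_neg_distrib]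
  rw [Finset.sum_comm (f := fun x y => P x y * log (∑ x', P x' y))]
  simp_rw [← Finset.sum_mul, negMulLog, neg_mul, Finset.sum_neg_distrib]
  ring

theorem negMulLog_le_one {t : ℝ} (h : 0 ≤ t) : Real.negMulLog t ≤ 1 := by
  rcases h.eq_or_lt with h0 | h0
  · simp [← h0]
  · have := Real.one_sub_inv_le_log_of_pos h0
    have h2 := mul_le_mul_of_nonneg_left this h
    rw [mul_sub, mul_inv_cancel₀ h0.ne'] at h2
    unfold Real.negMulLog
    linarith

theorem miJoint_bound {α β : Type} [Fintype α] [Fintype β] (P : α → β → ℝ)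
    (hP : ∀ x y, 0 ≤ P x y) (h1 : ∑ x, ∑ y, P x y = 1) :
    -(Fintype.card α * Fintype.card β : ℝ) ≤ miJoint P ∧
      miJoint P ≤ Fintype.card α + Fintype.card β := by
  have hx1 : ∀ x, ∑ y, P x y ≤ 1 := fun x => h1 ▸
    Finset.single_le_sum (f := fun x => ∑ y, P x y) (fun x _ => Finset.sum_nonneg fun y _ => hP x y)
      (Finset.mem_univ x)
  have hy1 : ∀ y, ∑ x, P x y ≤ 1 := fun y => by
    rw [← h1, Finset.sum_comm]
    exact Finset.single_le_sum (f := fun y => ∑ x, P x y)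
      (fun y _ => Finset.sum_nonneg fun x _ => hP x y) (Finset.mem_univ y)
  have hxy : ∀ x y, P x y ≤ 1 := fun x y =>
    (Finset.single_le_sum (fun y _ => hP x y) (Finset.mem_univ y)).trans (hx1 x)
  have hx0 : ∀ x, 0 ≤ ∑ y, P x y := fun x => Finset.sum_nonneg fun y _ => hP x y
  have hy0 : ∀ y, 0 ≤ ∑ x, P x y := fun y => Finset.sum_nonneg fun x _ => hP x y
  rw [miJoint_eq P hP]
  have a1 : 0 ≤ ∑ x, Real.negMulLog (∑ y, P x y) :=
    Finset.sum_nonneg fun x _ => Real.negMulLog_nonneg (hx0 x) (hx1 x)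
  have a2 : 0 ≤ ∑ y, Real.negMulLog (∑ x, P x y) :=
    Finset.sum_nonneg fun y _ => Real.negMulLog_nonneg (hy0 y) (hy1 y)
  have a3 : 0 ≤ ∑ x, ∑ y, Real.negMulLog (P x y) :=
    Finset.sum_nonneg fun x _ => Finset.sum_nonneg fun y _ => Real.negMulLog_nonneg (hP x y) (hxy x y)
  have b1 : ∑ x, Real.negMulLog (∑ y, P x y) ≤ ∑ x : α, 1 :=
    Finset.sum_le_sum fun x _ => negMulLog_le_one (hx0 x)
  have b2 : ∑ y, Real.negMulLog (∑ x, P x y) ≤ ∑ x : β, 1 :=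
    Finset.sum_le_sum fun y _ => negMulLog_le_one (hy0 y)
  have b3 : ∑ x, ∑ y, Real.negMulLog (P x y) ≤ ∑ x : α, ∑ y : β, 1 :=
    Finset.sum_le_sum fun x _ => Finset.sum_le_sum fun y _ => negMulLog_le_one (hP x y)
  simp only [Finset.sum_const, Finset.card_univ, nsmul_eq_mul, mul_one] at b1 b2 b3
  constructor <;> linarith

set_option linter.unusedSectionVars false

section wz
variable {𝒰 𝒱 𝒰h : Type} [Fintype 𝒰] [Fintype 𝒱] [Fintype 𝒰h]

theorem WZset_bdd (q : 𝒰 × 𝒱 → ℝ) (d : 𝒰 → 𝒰h → ℝ) (D : ℝ) : BddBelow (WZset q d D) := by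
  refine ⟨-(Fintype.card 𝒰 * Fintype.card (Fin (Fintype.card 𝒰 + 1)) : ℝ) -
    (Fintype.card 𝒱 + Fintype.card (Fin (Fintype.card 𝒰 + 1))), ?_⟩
  rintro ρ ⟨p, hp0, hp1, -, -, -, rfl⟩
  simp only [Fintype.sum_prod_type] at hp1
  have h1 := (miJoint_bound (fun (u : 𝒰) (a : Fin (Fintype.card 𝒰 + 1)) => ∑ v, p (a, u, v))
    (fun u a => Finset.sum_nonneg fun v _ => hp0 _) (by rw [Finset.sum_comm]; exact hp1)).1
  have h2 := (miJoint_bound (fun (v : 𝒱) (a : Fin (Fintype.card 𝒰 + 1)) => ∑ u, p (a, u, v))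
    (fun u a => Finset.sum_nonneg fun v _ => hp0 _) (by
      rw [Finset.sum_comm, ← hp1]; exact Finset.sum_congr rfl fun a _ => Finset.sum_comm)).2
  linarith

/-- The channel law of `V` given `U`. -/
noncomputable def chan (q : 𝒰 × 𝒱 → ℝ) (u : 𝒰) (v : 𝒱) : ℝ := q (u, v) / ∑ v', q (u, v')

/-- The unnormalised conditional-entropy cost. -/
noncomputable def cst (q : 𝒰 × 𝒱 → ℝ) (x : 𝒰 → ℝ) : ℝ :=
  ∑ v, Real.negMulLog (∑ u, x u * chan q u v) - ∑ u, Real.negMulLog (x u)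

theorem chan_nonneg {q : 𝒰 × 𝒱 → ℝ} (hq : ∀ p, 0 ≤ q p) (u : 𝒰) (v : 𝒱) : 0 ≤ chan q u v :=
  div_nonneg (hq _) (Finset.sum_nonneg fun _ _ => hq _)

theorem mul_chan {q : 𝒰 × 𝒱 → ℝ} (hq : ∀ p, 0 ≤ q p) (u : 𝒰) (v : 𝒱) :
    (∑ v', q (u, v')) * chan q u v = q (u, v) := by
  unfold chan
  by_cases h : ∑ v', q (u, v') = 0
  · have := (Finset.sum_eq_zero_iff_of_nonneg (fun v _ => hq (u, v))).1 h v (Finset.mem_univ v)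
    simp [h, this]
  · rw [mul_div_cancel₀ _ h]

theorem sum_chan {q : 𝒰 × 𝒱 → ℝ} (u : 𝒰) (h : ∑ v', q (u, v') ≠ 0) :
    ∑ v, chan q u v = 1 := by
  unfold chan
  rw [← Finset.sum_div, div_self h]

theorem cst_smul {q : 𝒰 × 𝒱 → ℝ} (x : 𝒰 → ℝ) (t : ℝ)
    (hx : ∀ u, ∑ v', q (u, v') = 0 → x u = 0) :
    cst q (fun u => t * x u) = t * cst q x := by
  have h1 : ∀ v, ∑ u, t * x u * chan q u v = t * ∑ u, x u * chan q u v := fun v => by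
    rw [Finset.mul_sum]; exact Finset.sum_congr rfl fun u _ => by ring
  have h2 : ∑ v, ∑ u, x u * chan q u v = ∑ u, x u := by
    rw [Finset.sum_comm]
    refine Finset.sum_congr rfl fun u _ => ?_
    rw [← Finset.mul_sum]
    by_cases h : ∑ v', q (u, v') = 0
    · simp [hx u h]
    · rw [sum_chan u h, mul_one]
  unfold cst
  simp_rw [h1, Real.negMulLog_mul, Finset.sum_add_distrib, ← Finset.sum_mul, ← Finset.mul_sum, h2]
  ring

theorem WZ_le [Nonempty 𝒰h] {ι : Type} [Fintype ι] [Nonempty ι] (q : 𝒰 × 𝒱 → ℝ) (hq : ∀ p, 0 ≤ q p)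
    (hq1 : ∑ p, q p = 1)
    (d : 𝒰 → 𝒰h → ℝ) (D : ℝ) (x : ι → 𝒰 → ℝ) (hx : ∀ i u, 0 ≤ x i u)
    (hxs : ∀ u, ∑ i, x i u = ∑ v, q (u, v)) (ψ : ι → 𝒱 → 𝒰h)
    (hD : ∑ i, ∑ u, ∑ v, x i u * chan q u v * d u (ψ i v) ≤ D) :
    WZ q d D ≤ ∑ u, Real.negMulLog (∑ v, q (u, v)) - ∑ v, Real.negMulLog (∑ u, q (u, v))
      + ∑ i, cst q (x i) := by
  classical
  have hx0 : ∀ i u, ∑ v', q (u, v') = 0 → x i u = 0 := fun i u h => by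
    rw [← hxs, Finset.sum_eq_zero_iff_of_nonneg (fun i _ => hx i u)] at h
    exact h i (Finset.mem_univ i)
  let del : ι → ℝ := fun i => ∑ u, ∑ v, x i u * chan q u v * d u (ψ i v)
  let b : ι → Option 𝒰 → ℝ := fun i k => k.elim (del i) (x i)
  let t : ι → ℝ := fun i => if x i = 0 then 0 else 1
  have hts : ∀ f : ι → ℝ, (∀ i, x i = 0 → f i = 0) → ∑ i, t i * f i = ∑ i, f i := by
    intro f hf
    refine Finset.sum_congr rfl fun i _ => ?_
    by_cases h : x i = 0
    · simp [hf i h]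
    · simp [t, h]
  obtain ⟨t', ht0, htc, htb, htcost⟩ := lp b (fun i => cst q (x i)) (fun k => k.elim 0 (fun _ => 1))
    _ t (fun i => by simp only [t]; split_ifs <;> norm_num) (by
      intro i hi
      have hxi : x i ≠ 0 := by
        intro h; simp [t, h] at hi
      obtain ⟨u, hu⟩ := Function.ne_iff.1 hxi
      rw [Fintype.sum_option]
      simp only [Option.elim, b, zero_mul, zero_add, one_mul]
      exact Finset.sum_pos' (fun u _ => hx i u) ⟨u, Finset.mem_univ _, lt_of_le_of_ne (hx i u) (Ne.symm hu)⟩) le_rfl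
  rw [Fintype.card_option] at htc
  obtain ⟨a, τ, hτ, hτs⟩ := reindex t' ht0 _ htc
  have e1 : ∀ u, ∑ j, τ j * x (a j) u = ∑ v, q (u, v) := fun u => by
    rw [hτs (fun i => x i u), ← hxs]
    rw [← hts (fun i => x i u) (fun i h => by simp [h])]
    exact htb (some u)
  have e2 : ∑ j, τ j * del (a j) ≤ D := by
    rw [hτs del]
    refine le_trans (le_of_eq ?_) hD
    rw [← hts (fun i => ∑ u, ∑ v, x i u * chan q u v * d u (ψ i v)) (fun i h => by simp [h])]
    exact htb none
  have e3 : ∑ j, cst q (fun u => τ j * x (a j) u) ≤ ∑ i, cst q (x i) := by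
    simp_rw [fun j => cst_smul (x (a j)) (τ j) (hx0 (a j))]
    rw [hτs (fun i => cst q (x i))]
    refine htcost.trans (le_of_eq (hts _ fun i h => ?_))
    simp [cst, h]
  set y : Fin (Fintype.card 𝒰 + 1) → 𝒰 → ℝ := fun j u => τ j * x (a j) u with hy
  have hy0 : ∀ j u, 0 ≤ y j u := fun j u => mul_nonneg (hτ j) (hx _ _)
  have hyz : ∀ j u, ∑ v', q (u, v') = 0 → y j u = 0 := fun j u h => by simp [hy, hx0 _ _ h]
  have hys : ∀ j u, ∑ v, y j u * chan q u v = y j u := fun j u => by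
    rw [← Finset.mul_sum]
    by_cases h : ∑ v', q (u, v') = 0
    · simp [hyz j u h]
    · rw [sum_chan u h, mul_one]
  have hmarg : ∀ u v, ∑ j, y j u * chan q u v = q (u, v) := fun u v => by
    rw [← Finset.sum_mul, e1, mul_chan hq]
  refine le_trans (csInf_le (WZset_bdd q d D) ?_) (add_le_add_right e3 _)
  refine ⟨fun z => y z.1 z.2.1 * chan q z.2.1 z.2.2, ?_, ?_, hmarg, ?_, ⟨fun j => ψ (a j), ?_⟩, ?_⟩
  · exact fun z => mul_nonneg (hy0 _ _) (chan_nonneg hq _ _)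
  · rw [← hq1]
    simp only [Fintype.sum_prod_type, hys]
    rw [Finset.sum_comm]
    exact Finset.sum_congr rfl fun u _ => e1 u
  · intro j u v h
    simp only [hys, hmarg] at h ⊢
    rw [e1, mul_assoc, mul_comm (chan q u v), mul_chan hq]
  · refine le_trans (le_of_eq ?_) e2
    refine Finset.sum_congr rfl fun j _ => ?_
    simp only [del, Finset.mul_sum, hy]
    exact Finset.sum_congr rfl fun u _ => Finset.sum_congr rfl fun v _ => by ring
  · rw [miJoint_eq _ (fun u j => Finset.sum_nonneg fun v _ => mul_nonneg (hy0 _ _) (chan_nonneg hq _ _)),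
      miJoint_eq _ (fun v j => Finset.sum_nonneg fun u _ => mul_nonneg (hy0 _ _) (chan_nonneg hq _ _))]
    simp only [hys]
    have f1 : ∀ u, ∑ j, y j u = ∑ v, q (u, v) := e1
    have f2 : ∀ v, ∑ j, ∑ u, y j u * chan q u v = ∑ u, q (u, v) := fun v => by
      rw [Finset.sum_comm]; exact Finset.sum_congr rfl fun u _ => hmarg u v
    have f3 : ∀ j, ∑ v, ∑ u, y j u * chan q u v = ∑ u, y j u := fun j => by
      rw [Finset.sum_comm]; exact Finset.sum_congr rfl fun u _ => hys j u
    simp_rw [f1, f2, f3, cst, Finset.sum_sub_distrib]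
    rw [Finset.sum_comm (f := fun (u : 𝒰) (j : Fin (Fintype.card 𝒰 + 1)) => Real.negMulLog (y j u)),
      Finset.sum_comm (f := fun (v : 𝒱) (j : Fin (Fintype.card 𝒰 + 1)) => Real.negMulLog (∑ u, y j u * chan q u v))]
    ring

end wz
end WZaux

namespace WZaux

section rv
variable {Ω α β γ : Type} [Fintype Ω] [DecidableEq α] [DecidableEq β] [DecidableEq γ]

theorem prob_congr (μ : Ω → ℝ) (X : Ω → α) (X' : Ω → β) (a : α) (b : β)
    (h : ∀ ω, X ω = a ↔ X' ω = b) : prob μ X a = prob μ X' b := by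
  unfold prob
  exact Finset.sum_congr rfl fun ω _ => by simp [h ω]

theorem prob_le {μ : Ω → ℝ} (h0 : ∀ ω, 0 ≤ μ ω) (X : Ω → α) (X' : Ω → β) (a : α) (b : β)
    (h : ∀ ω, X ω = a → X' ω = b) : prob μ X a ≤ prob μ X' b := by
  unfold prob
  refine Finset.sum_le_sum fun ω _ => ?_
  by_cases h1 : X ω = a
  · simp [h1, h ω h1]
  · simp only [h1, if_false]; split_ifs <;> simp [h0]

theorem prob_zero (μ : Ω → ℝ) (X : Ω → α) (a : α) (h : ∀ ω, X ω ≠ a) : prob μ X a = 0 := by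
  unfold prob
  exact Finset.sum_eq_zero fun ω _ => by simp [h ω]

theorem marg_left [Fintype β] (μ : Ω → ℝ) (X : Ω → α) (Y : Ω → β) (a : α) :
    prob μ X a = ∑ b, prob μ (fun ω => (Y ω, X ω)) (b, a) := by
  unfold prob
  rw [Finset.sum_comm]
  refine Finset.sum_congr rfl fun ω _ => ?_
  simp [Prod.ext_iff, ite_and]

theorem marg_right [Fintype β] (μ : Ω → ℝ) (X : Ω → α) (Y : Ω → β) (a : α) :
    prob μ X a = ∑ b, prob μ (fun ω => (X ω, Y ω)) (a, b) := by
  rw [marg_left μ X Y]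
  exact Finset.sum_congr rfl fun b _ => prob_congr _ _ _ _ _ fun ω => by
    simp [Prod.ext_iff, and_comm]

theorem condMI_nonneg [Fintype α] [Fintype β] [Fintype γ] {μ : Ω → ℝ} (h : ∀ ω, 0 ≤ μ ω)
    (h1 : ∑ ω, μ ω = 1) (X : Ω → α) (Y : Ω → β) (Z : Ω → γ) : 0 ≤ condMI μ X Y Z := by
  have G := gibbs h h1 (fun ω => (X ω, Y ω, Z ω))
    (fun p => prob μ (fun ω => (X ω, Z ω)) (p.1, p.2.2) * prob μ (fun ω => (Y ω, Z ω)) (p.2.1, p.2.2)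
      / prob μ Z p.2.2)
    (fun p => div_nonneg (mul_nonneg (prob_nonneg h _ _) (prob_nonneg h _ _)) (prob_nonneg h _ _))
    (by
      simp only [Fintype.sum_prod_type]
      rw [← h1, ← sum_prob μ Z]
      have : ∀ x, ∑ y, ∑ z, prob μ (fun ω => (X ω, Z ω)) (x, z) * prob μ (fun ω => (Y ω, Z ω)) (y, z)
          / prob μ Z z = ∑ z, prob μ (fun ω => (X ω, Z ω)) (x, z) * prob μ Z z / prob μ Z z := by
        intro x
        rw [Finset.sum_comm]
        refine Finset.sum_congr rfl fun z _ => ?_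
        rw [← Finset.sum_div, ← Finset.mul_sum, ← marg_left]
      simp_rw [this]
      rw [Finset.sum_comm]
      refine le_of_eq (Finset.sum_congr rfl fun z _ => ?_)
      rw [← Finset.sum_div, ← Finset.sum_mul, ← marg_left, mul_self_div_self])
    (fun ω hω => div_pos (mul_pos (prob_pos h (fun ω => (X ω, Z ω)) ω hω)
      (prob_pos h (fun ω => (Y ω, Z ω)) ω hω)) (prob_pos h Z ω hω))
  have e : ∑ ω, μ ω * Real.log (prob μ (fun ω => (X ω, Z ω)) (X ω, Z ω) *
      prob μ (fun ω => (Y ω, Z ω)) (Y ω, Z ω) / prob μ Z (Z ω)) =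
      ∑ ω, (μ ω * Real.log (prob μ (fun ω => (X ω, Z ω)) (X ω, Z ω)) +
      μ ω * Real.log (prob μ (fun ω => (Y ω, Z ω)) (Y ω, Z ω)) -
      μ ω * Real.log (prob μ Z (Z ω))) := by
    refine Finset.sum_congr rfl fun ω _ => ?_
    rcases (h ω).eq_or_lt with h0 | h0
    · simp [← h0]
    · have p1 := prob_pos h (fun ω => (X ω, Z ω)) ω h0
      have p2 := prob_pos h (fun ω => (Y ω, Z ω)) ω h0
      have p3 := prob_pos h Z ω h0
      rw [Real.log_div (mul_pos p1 p2).ne' p3.ne', Real.log_mul p1.ne' p2.ne']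
      ring
  simp only at G
  rw [e, Finset.sum_sub_distrib, Finset.sum_add_distrib] at G
  unfold condMI
  simp only [entH_eq]
  linarith

end rv

theorem sum_prod_pi {N : ℕ} {α : Type} [Fintype α] (f : Fin N → α → ℝ) :
    ∑ x : Fin N → α, ∏ i, f i (x i) = ∏ i, ∑ a, f i a := by
  classical
  rw [Finset.prod_univ_sum]
  simp

section main
variable {Ω 𝒰 𝒱 𝒰h 𝒦 𝒴 : Type} [Fintype Ω]
    [Fintype 𝒰] [DecidableEq 𝒰] [Fintype 𝒱] [DecidableEq 𝒱]
    [Fintype 𝒦] [DecidableEq 𝒦] [Fintype 𝒴] [DecidableEq 𝒴]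
    {μ : Ω → ℝ} {N : ℕ} {U : Fin N → Ω → 𝒰} {V : Fin N → Ω → 𝒱} {q : 𝒰 × 𝒱 → ℝ}
    {K : Ω → 𝒦} {Y : Ω → 𝒴}

theorem prob_pair (hq1 : ∑ p, q p = 1)
    (hiid : ∀ f : Fin N → 𝒰 × 𝒱,
      prob μ (fun ω => fun i => (U i ω, V i ω)) f = ∏ i, q (f i)) (i : Fin N) (p : 𝒰 × 𝒱) :
    prob μ (fun ω => (U i ω, V i ω)) p = q p := by
  rw [prob_comp μ (fun ω => fun i => (U i ω, V i ω)) (fun f => f i) p]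
  simp_rw [hiid]
  have : ∀ f : Fin N → 𝒰 × 𝒱, (if f i = p then ∏ j, q (f j) else 0) =
      ∏ j, (if j = i then (if f j = p then q (f j) else 0) else q (f j)) := by
    intro f
    rw [← Finset.mul_prod_erase _ _ (Finset.mem_univ i)]
    rw [← Finset.mul_prod_erase Finset.univ
      (fun j => (if j = i then (if f j = p then q (f j) else 0) else q (f j))) (Finset.mem_univ i)]
    have h : ∏ x ∈ Finset.univ.erase i, (if x = i then (if f x = p then q (f x) else 0) else q (f x))
        = ∏ x ∈ Finset.univ.erase i, q (f x) :=
      Finset.prod_congr rfl fun x hx => by simp [Finset.ne_of_mem_erase hx]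
    rw [h]
    simp [ite_mul]
  simp_rw [this]
  rw [sum_prod_pi (fun j a => if j = i then (if a = p then q a else 0) else q a)]
  rw [Finset.prod_eq_single i]
  · simp
  · intro j _ hj; simp [hj, hq1]
  · simp

theorem prob_U (hq1 : ∑ p, q p = 1)
    (hiid : ∀ f : Fin N → 𝒰 × 𝒱,
      prob μ (fun ω => fun i => (U i ω, V i ω)) f = ∏ i, q (f i)) (i : Fin N) (u : 𝒰) :
    prob μ (U i) u = ∑ v, q (u, v) := by
  rw [marg_right μ (U i) (V i)]
  exact Finset.sum_congr rfl fun v _ => prob_pair hq1 hiid i _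

theorem prob_V (hq1 : ∑ p, q p = 1)
    (hiid : ∀ f : Fin N → 𝒰 × 𝒱,
      prob μ (fun ω => fun i => (U i ω, V i ω)) f = ∏ i, q (f i)) (i : Fin N) (v : 𝒱) :
    prob μ (V i) v = ∑ u, q (u, v) := by
  rw [marg_left μ (V i) (U i)]
  exact Finset.sum_congr rfl fun v _ => prob_pair hq1 hiid i _

theorem prob_UKV
    (hiid : ∀ f : Fin N → 𝒰 × 𝒱,
      prob μ (fun ω => fun i => (U i ω, V i ω)) f = ∏ i, q (f i))
    (hKindep : ∀ (k : 𝒦) (f : Fin N → 𝒰 × 𝒱),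
      prob μ (fun ω => (K ω, fun i => (U i ω, V i ω))) (k, f) =
        prob μ K k * prob μ (fun ω => fun i => (U i ω, V i ω)) f)
    (u : Fin N → 𝒰) (k : 𝒦) (v : Fin N → 𝒱) :
    prob μ (fun ω => ((fun i => U i ω), K ω, fun i => V i ω)) (u, k, v) =
      prob μ K k * ∏ i, q (u i, v i) := by
  rw [← hiid (fun i => (u i, v i)), ← hKindep]
  refine prob_congr _ _ _ _ _ fun ω => ?_
  simp only [Prod.ext_iff, funext_iff, forall_and]
  tauto

theorem prob_KV
    (hiid : ∀ f : Fin N → 𝒰 × 𝒱,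
      prob μ (fun ω => fun i => (U i ω, V i ω)) f = ∏ i, q (f i))
    (hKindep : ∀ (k : 𝒦) (f : Fin N → 𝒰 × 𝒱),
      prob μ (fun ω => (K ω, fun i => (U i ω, V i ω))) (k, f) =
        prob μ K k * prob μ (fun ω => fun i => (U i ω, V i ω)) f)
    (k : 𝒦) (v : Fin N → 𝒱) :
    prob μ (fun ω => (K ω, fun i => V i ω)) (k, v) =
      prob μ K k * ∏ i, ∑ u, q (u, v i) := by
  rw [marg_left μ _ (fun ω => fun i => U i ω)]
  simp_rw [prob_UKV hiid hKindep]
  rw [← Finset.mul_sum, sum_prod_pi (fun i u => q (u, v i))]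

theorem prob_UK
    (hiid : ∀ f : Fin N → 𝒰 × 𝒱,
      prob μ (fun ω => fun i => (U i ω, V i ω)) f = ∏ i, q (f i))
    (hKindep : ∀ (k : 𝒦) (f : Fin N → 𝒰 × 𝒱),
      prob μ (fun ω => (K ω, fun i => (U i ω, V i ω))) (k, f) =
        prob μ K k * prob μ (fun ω => fun i => (U i ω, V i ω)) f)
    (u : Fin N → 𝒰) (k : 𝒦) :
    prob μ (fun ω => ((fun i => U i ω), K ω)) (u, k) =
      prob μ K k * ∏ i, ∑ v, q (u i, v) := by
  rw [marg_right μ _ (fun ω => fun i => V i ω)]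
  rw [← sum_prod_pi (fun i v => q (u i, v)), Finset.mul_sum]
  refine Finset.sum_congr rfl fun v _ => ?_
  rw [← prob_UKV hiid hKindep]
  refine prob_congr _ _ _ _ _ fun ω => ?_
  simp only [Prod.ext_iff]
  tauto

theorem prob_full (hμ0 : ∀ ω, 0 ≤ μ ω) (hq : ∀ p, 0 ≤ q p)
    (hiid : ∀ f : Fin N → 𝒰 × 𝒱,
      prob μ (fun ω => fun i => (U i ω, V i ω)) f = ∏ i, q (f i))
    (hKindep : ∀ (k : 𝒦) (f : Fin N → 𝒰 × 𝒱),
      prob μ (fun ω => (K ω, fun i => (U i ω, V i ω))) (k, f) =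
        prob μ K k * prob μ (fun ω => fun i => (U i ω, V i ω)) f)
    (hYci : CondIndep μ Y (fun ω => fun i => V i ω)
      (fun ω => ((fun i => U i ω), K ω)))
    (y : 𝒴) (v : Fin N → 𝒱) (u : Fin N → 𝒰) (k : 𝒦) :
    prob μ (fun ω => (Y ω, (fun i => V i ω), ((fun i => U i ω), K ω))) (y, v, (u, k)) =
      prob μ (fun ω => (Y ω, ((fun i => U i ω), K ω))) (y, (u, k)) * ∏ i, chan q (u i) (v i) := by
  rcases (prob_nonneg hμ0 (fun ω => ((fun i => U i ω), K ω)) (u, k)).eq_or_lt with h | h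
  · have h1 := prob_le hμ0 (fun ω => (Y ω, (fun i => V i ω), ((fun i => U i ω), K ω)))
      (fun ω => ((fun i => U i ω), K ω)) (y, v, (u, k)) (u, k)
      (fun ω h => by simp only [Prod.ext_iff] at h ⊢; tauto)
    have h2 := prob_le hμ0 (fun ω => (Y ω, ((fun i => U i ω), K ω)))
      (fun ω => ((fun i => U i ω), K ω)) (y, (u, k)) (u, k)
      (fun ω h => by simp only [Prod.ext_iff] at h ⊢; tauto)
    rw [← h] at h1 h2
    rw [le_antisymm h1 (prob_nonneg hμ0 _ _), le_antisymm h2 (prob_nonneg hμ0 _ _), zero_mul]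
  · have h1 := hYci y v (u, k) h
    have h2 : prob μ (fun ω => ((fun i => V i ω), ((fun i => U i ω), K ω))) (v, (u, k)) =
        prob μ (fun ω => ((fun i => U i ω), K ω)) (u, k) * ∏ i, chan q (u i) (v i) := by
      rw [prob_UK hiid hKindep, mul_assoc, ← Finset.prod_mul_distrib]
      simp_rw [mul_chan hq]
      rw [← prob_UKV hiid hKindep]
      refine prob_congr _ _ _ _ _ fun ω => ?_
      simp only [Prod.ext_iff]
      tauto
    rw [h2] at h1
    apply mul_right_cancel₀ h.ne'
    rw [h1]; ring

theorem markov (hμ0 : ∀ ω, 0 ≤ μ ω) (hq : ∀ p, 0 ≤ q p)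
    (hiid : ∀ f : Fin N → 𝒰 × 𝒱,
      prob μ (fun ω => fun i => (U i ω, V i ω)) f = ∏ i, q (f i))
    (hKindep : ∀ (k : 𝒦) (f : Fin N → 𝒰 × 𝒱),
      prob μ (fun ω => (K ω, fun i => (U i ω, V i ω))) (k, f) =
        prob μ K k * prob μ (fun ω => fun i => (U i ω, V i ω)) f)
    (hYci : CondIndep μ Y (fun ω => fun i => V i ω)
      (fun ω => ((fun i => U i ω), K ω)))
    (v0 : 𝒱) (i : Fin N) (a : 𝒴 × 𝒦 × (Fin N → 𝒱)) (u : 𝒰) (v : 𝒱) :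
    prob μ (fun ω => ((Y ω, K ω, Function.update (fun j => V j ω) i v0), U i ω, V i ω)) (a, u, v) =
      prob μ (fun ω => ((Y ω, K ω, Function.update (fun j => V j ω) i v0), U i ω)) (a, u)
        * chan q u v := by
  obtain ⟨y, k, w⟩ := a
  have hG : ∃ G : ℝ, ∀ v,
      prob μ (fun ω => ((Y ω, K ω, Function.update (fun j => V j ω) i v0), U i ω, V i ω))
        ((y, k, w), u, v) = G * chan q u v := by
    by_cases hw : w i = v0
    · refine ⟨∑ un : Fin N → 𝒰, if un i = u then
        prob μ (fun ω => (Y ω, ((fun i => U i ω), K ω))) (y, (un, k)) *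
          ∏ j ∈ Finset.univ.erase i, chan q (un j) (w j) else 0, fun v => ?_⟩
      rw [marg_left μ _ (fun ω => fun i => U i ω), Finset.sum_mul]
      refine Finset.sum_congr rfl fun un _ => ?_
      by_cases hu : un i = u
      · rw [if_pos hu]
        have e : prob μ (fun ω => ((fun i => U i ω), (Y ω, K ω, Function.update (fun j => V j ω) i v0), U i ω, V i ω))
            (un, (y, k, w), u, v) = prob μ (fun ω => (Y ω, (fun i => V i ω), ((fun i => U i ω), K ω)))
            (y, Function.update w i v, (un, k)) := by
          refine prob_congr _ _ _ _ _ fun ω => ?_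
          simp only [Prod.ext_iff]
          have hv : (Function.update (fun j => V j ω) i v0 = w ∧ V i ω = v) ↔
              (fun j => V j ω) = Function.update w i v := by
            rw [Function.update_eq_iff, Function.eq_update_iff]
            constructor
            · rintro ⟨⟨_, h2⟩, h3⟩; exact ⟨h3, h2⟩
            · rintro ⟨h3, h2⟩; exact ⟨⟨hw.symm, h2⟩, h3⟩
          have hu' : (fun i => U i ω) = un → U i ω = u := fun h => by rw [← hu, ← h]
          rw [← hv]
          tauto
        rw [e, prob_full hμ0 hq hiid hKindep hYci, ← Finset.mul_prod_erase _ _ (Finset.mem_univ i)]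
        have e2 : ∏ x ∈ Finset.univ.erase i, chan q (un x) (Function.update w i v x) =
            ∏ x ∈ Finset.univ.erase i, chan q (un x) (w x) :=
          Finset.prod_congr rfl fun x hx => by
            rw [Function.update_of_ne (Finset.ne_of_mem_erase hx)]
        rw [e2, Function.update_self, hu]
        ring
      · rw [if_neg hu, zero_mul]
        refine prob_zero _ _ _ fun ω h => hu ?_
        simp only [Prod.ext_iff] at h
        rw [← h.1, ← h.2.2.1]
    · refine ⟨0, fun v => ?_⟩
      rw [zero_mul]
      refine prob_zero _ _ _ fun ω h => hw ?_
      simp only [Prod.ext_iff] at h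
      rw [← h.1.2.2, Function.update_self]
  obtain ⟨G, hG⟩ := hG
  have hm : prob μ (fun ω => ((Y ω, K ω, Function.update (fun j => V j ω) i v0), U i ω)) ((y, k, w), u)
      = G * ∑ v, chan q u v := by
    rw [marg_right μ _ (V i), Finset.mul_sum]
    refine Finset.sum_congr rfl fun v _ => ?_
    rw [← hG]
    refine prob_congr _ _ _ _ _ fun ω => ?_
    simp only [Prod.ext_iff]
    tauto
  rw [hG, hm]
  by_cases h : ∑ v', q (u, v') = 0
  · simp [chan, h]
  · rw [sum_chan u h, mul_one]

end main
end WZaux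

open WZaux

/-- Source-coding converse step: for i.i.d. pairs `(U_i,V_i)` with common law `q`,
`K` independent of `(U^N,V^N)`, `Y` conditionally independent of `V^N` given
`(U^N,K)`, and a decoder `g(Y,V^N,K)` achieving average distortion at most `D`,
one has `I(U^N; Y | (K,V^N)) ≥ N·R_{U|V}(D)`. -/
theorem stmt15 {Ω 𝒰 𝒱 𝒰h 𝒦 𝒴 : Type} [Fintype Ω]
    [Fintype 𝒰] [DecidableEq 𝒰] [Nonempty 𝒰]
    [Fintype 𝒱] [DecidableEq 𝒱] [Nonempty 𝒱]
    [Fintype 𝒰h] [DecidableEq 𝒰h] [Nonempty 𝒰h]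
    [Fintype 𝒦] [DecidableEq 𝒦] [Nonempty 𝒦]
    [Fintype 𝒴] [DecidableEq 𝒴] [Nonempty 𝒴]
    (μ : Ω → ℝ) (hμ0 : ∀ ω, 0 ≤ μ ω) (hμ1 : ∑ ω, μ ω = 1)
    (d : 𝒰 → 𝒰h → ℝ) (hd : ∀ u uh, 0 ≤ d u uh)
    (N : ℕ) (hN : 0 < N)
    (U : Fin N → Ω → 𝒰) (V : Fin N → Ω → 𝒱)
    (q : 𝒰 × 𝒱 → ℝ)
    (hiid : ∀ f : Fin N → 𝒰 × 𝒱,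
      prob μ (fun ω => fun i => (U i ω, V i ω)) f = ∏ i, q (f i))
    (K : Ω → 𝒦)
    (hKindep : ∀ (k : 𝒦) (f : Fin N → 𝒰 × 𝒱),
      prob μ (fun ω => (K ω, fun i => (U i ω, V i ω))) (k, f) =
        prob μ K k * prob μ (fun ω => fun i => (U i ω, V i ω)) f)
    (Y : Ω → 𝒴)
    (hYci : CondIndep μ Y (fun ω => fun i => V i ω)
      (fun ω => ((fun i => U i ω), K ω)))
    (g : 𝒴 × (Fin N → 𝒱) × 𝒦 → Fin N → 𝒰h)
    (D : ℝ)
    (hdist : (1 / N : ℝ) *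
        (∑ i : Fin N, ∑ ω, μ ω * d (U i ω) (g (Y ω, (fun j => V j ω), K ω) i)) ≤ D) :
    (N : ℝ) * WZ q d D ≤
      condMI μ (fun ω => fun i => U i ω) Y (fun ω => (K ω, fun i => V i ω)) := by
  classical
  rcases (WZset q d D).eq_empty_or_nonempty with hE | ⟨ρ, p, hp0, hp1, hpm, -, -, -⟩
  · rw [WZ, hE, Real.sInf_empty, mul_zero]
    exact WZaux.condMI_nonneg hμ0 hμ1 _ _ _
  have hq : ∀ z, 0 ≤ q z := fun z => by
    rw [show z = (z.1, z.2) from rfl, ← hpm]; exact Finset.sum_nonneg fun _ _ => hp0 _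
  have hq1 : ∑ z, q z = 1 := by
    have h1 : ∑ z, q z = ∑ z, ∑ a, p (a, z) :=
      Finset.sum_congr rfl fun z _ => (hpm z.1 z.2).symm
    rw [h1, Finset.sum_comm, ← hp1]
    exact (Fintype.sum_prod_type p).symm
  let v0 : 𝒱 := Classical.arbitrary 𝒱
  have hNpos : (0 : ℝ) < N := by exact_mod_cast hN
  let A : Fin N → Ω → 𝒴 × 𝒦 × (Fin N → 𝒱) := fun i ω =>
    (Y ω, K ω, Function.update (fun j => V j ω) i v0)
  have hmk : ∀ i a u v, prob μ (fun ω => (A i ω, U i ω, V i ω)) (a, u, v) =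
      prob μ (fun ω => (A i ω, U i ω)) (a, u) * chan q u v :=
    fun i a u v => markov hμ0 hq hiid hKindep hYci v0 i a u v
  have hAU : ∀ i u, ∑ a, prob μ (fun ω => (A i ω, U i ω)) (a, u) = ∑ v, q (u, v) := fun i u => by
    rw [← marg_left, prob_U hq1 hiid]
  have hAV : ∀ i a v, ∑ u, prob μ (fun ω => (A i ω, U i ω)) (a, u) * chan q u v =
      prob μ (fun ω => (A i ω, V i ω)) (a, v) := fun i a v => by
    simp_rw [← hmk]
    rw [marg_left μ _ (U i)]
    refine Finset.sum_congr rfl fun u _ => prob_congr _ _ _ _ _ fun ω => ?_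
    simp only [Prod.ext_iff]
    tauto
  have hz : ∀ i a u, ∑ v', q (u, v') = 0 → prob μ (fun ω => (A i ω, U i ω)) (a, u) = 0 := by
    intro i a u h
    rw [← hAU i, Finset.sum_eq_zero_iff_of_nonneg (fun _ _ => prob_nonneg hμ0 _ _)] at h
    exact h a (Finset.mem_univ a)
  -- single-letter bound
  have hne : Nonempty (Fin N × (𝒴 × 𝒦 × (Fin N → 𝒱))) := ⟨(⟨0, hN⟩, Classical.arbitrary _)⟩
  have hW := WZ_le (ι := Fin N × (𝒴 × 𝒦 × (Fin N → 𝒱)))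
    q hq hq1 d D
    (fun ia u => (1 / N : ℝ) * prob μ (fun ω => (A ia.1 ω, U ia.1 ω)) (ia.2, u))
    (fun ia u => mul_nonneg (by positivity) (prob_nonneg hμ0 _ _))
    (fun u => by
      rw [← Finset.mul_sum, Fintype.sum_prod_type]
      simp_rw [hAU]
      simp only [Finset.sum_const, Finset.card_univ, Fintype.card_fin, nsmul_eq_mul]
      field_simp)
    (fun ia v => g (ia.2.1, Function.update ia.2.2.2 ia.1 v, ia.2.2.1) ia.1)
    (by
      refine le_trans (le_of_eq ?_) hdist
      rw [Fintype.sum_prod_type, Finset.mul_sum]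
      refine Finset.sum_congr rfl fun i _ => ?_
      have e := expect_eq μ (fun ω => (A i ω, U i ω, V i ω))
        (fun z => d z.2.1 (g (z.1.1, Function.update z.1.2.2 i z.2.2, z.1.2.1) i))
      have e' : ∑ ω, μ ω * d (U i ω) (g (Y ω, (fun j => V j ω), K ω) i) =
          ∑ z, prob μ (fun ω => (A i ω, U i ω, V i ω)) z *
            d z.2.1 (g (z.1.1, Function.update z.1.2.2 i z.2.2, z.1.2.1) i) := by
        rw [← e]
        refine Finset.sum_congr rfl fun ω _ => ?_
        simp only [A, Function.update_idem]
        rw [Function.update_eq_self i (fun j => V j ω)]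
      rw [e', Fintype.sum_prod_type (fun z => prob μ (fun ω => (A i ω, U i ω, V i ω)) z *
            d z.2.1 (g (z.1.1, Function.update z.1.2.2 i z.2.2, z.1.2.1) i)), Finset.mul_sum]
      refine Finset.sum_congr rfl fun (a : 𝒴 × 𝒦 × (Fin N → 𝒱)) _ => ?_
      rw [Fintype.sum_prod_type, Finset.mul_sum]
      refine Finset.sum_congr rfl fun (u : 𝒰) _ => ?_
      rw [Finset.mul_sum]
      refine Finset.sum_congr rfl fun v _ => ?_
      rw [hmk]
      ring)
  have hsum : ∑ ia : Fin N × (𝒴 × 𝒦 × (Fin N → 𝒱)),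
      cst q (fun u => (1 / N : ℝ) * prob μ (fun ω => (A ia.1 ω, U ia.1 ω)) (ia.2, u)) =
      (1 / N : ℝ) * ∑ i, (entH μ (fun ω => (A i ω, V i ω)) - entH μ (fun ω => (A i ω, U i ω))) := by
    rw [Fintype.sum_prod_type, Finset.mul_sum]
    refine Finset.sum_congr rfl fun i _ => ?_
    simp_rw [fun a => cst_smul (fun u => prob μ (fun ω => (A i ω, U i ω)) (a, u)) (1 / N : ℝ) (hz i a)]
    rw [← Finset.mul_sum]
    congr 1
    simp_rw [cst, hAV, Finset.sum_sub_distrib]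
    rw [entH_eq', entH_eq']
    congr 1
    · exact (Fintype.sum_prod_type
        (fun z => Real.negMulLog (prob μ (fun ω => (A i ω, V i ω)) z))).symm
    · exact (Fintype.sum_prod_type
        (fun z => Real.negMulLog (prob μ (fun ω => (A i ω, U i ω)) z))).symm
  rw [hsum] at hW
  have hHU : ∀ i, entH μ (U i) = ∑ u, Real.negMulLog (∑ v, q (u, v)) := fun i => by
    rw [entH_eq']; simp_rw [prob_U hq1 hiid]
  have hHV : ∀ i, entH μ (V i) = ∑ v, Real.negMulLog (∑ u, q (u, v)) := fun i => by
    rw [entH_eq']; simp_rw [prob_V hq1 hiid]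
  have hW2 : (N : ℝ) * WZ q d D ≤ ∑ i, (entH μ (U i) - entH μ (V i) +
      (entH μ (fun ω => (A i ω, V i ω)) - entH μ (fun ω => (A i ω, U i ω)))) := by
    refine (mul_le_mul_of_nonneg_left hW hNpos.le).trans (le_of_eq ?_)
    rw [Finset.sum_add_distrib]
    simp_rw [hHU, hHV]
    simp only [Finset.sum_const, Finset.card_univ, Fintype.card_fin, nsmul_eq_mul]
    field_simp
  refine hW2.trans ?_
  -- information inequality
  let Z : Ω → 𝒴 × 𝒦 × (Fin N → 𝒱) := fun ω => (Y ω, K ω, fun i => V i ω)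
  have G := gibbs hμ0 hμ1 (fun ω => ((fun i => U i ω), Z ω))
    (fun p => prob μ Z p.2 * ∏ i, (prob μ (fun ω => (U i ω, Z ω)) (p.1 i, p.2) / prob μ Z p.2))
    (fun p => mul_nonneg (prob_nonneg hμ0 _ _) (Finset.prod_nonneg fun i _ =>
      div_nonneg (prob_nonneg hμ0 _ _) (prob_nonneg hμ0 _ _)))
    (by
      rw [Fintype.sum_prod_type, Finset.sum_comm, ← hμ1, ← sum_prob μ Z]
      refine Finset.sum_le_sum fun z _ => ?_
      simp only
      rw [← Finset.mul_sum, sum_prod_pi (fun i u => prob μ (fun ω => (U i ω, Z ω)) (u, z) / prob μ Z z)]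
      simp_rw [← Finset.sum_div, ← marg_left]
      refine mul_le_of_le_one_right (prob_nonneg hμ0 _ _) (Finset.prod_le_one (fun i _ =>
        div_nonneg (prob_nonneg hμ0 _ _) (prob_nonneg hμ0 _ _)) fun i _ => div_self_le_one _))
    (fun ω hω => mul_pos (prob_pos hμ0 Z ω hω) (Finset.prod_pos fun i _ =>
      div_pos (prob_pos hμ0 (fun ω => (U i ω, Z ω)) ω hω) (prob_pos hμ0 Z ω hω)))
  have hpt : ∀ ω, 0 < μ ω →
      Real.log (prob μ Z (Z ω) * ∏ i, (prob μ (fun ω => (U i ω, Z ω)) (U i ω, Z ω) / prob μ Z (Z ω)))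
      = Real.log (prob μ Z (Z ω))
        + Real.log (prob μ (fun ω => ((fun i => U i ω), K ω, fun i => V i ω))
            ((fun i => U i ω), K ω, fun i => V i ω))
        - Real.log (prob μ (fun ω => (K ω, fun i => V i ω)) (K ω, fun i => V i ω))
        + ∑ i, (-Real.log (prob μ (U i) (U i ω)) + Real.log (prob μ (V i) (V i ω))
          - Real.log (prob μ (fun ω => (A i ω, V i ω)) (A i ω, V i ω))
          + Real.log (prob μ (fun ω => (A i ω, U i ω)) (A i ω, U i ω))) := by
    intro ω hω
    have pU : ∀ i, 0 < prob μ (U i) (U i ω) := fun i => prob_pos hμ0 _ ω hω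
    have pV : ∀ i, 0 < prob μ (V i) (V i ω) := fun i => prob_pos hμ0 _ ω hω
    have pUV : ∀ i, 0 < q (U i ω, V i ω) := fun i => by
      rw [← prob_pair hq1 hiid i]; exact prob_pos hμ0 (fun ω => (U i ω, V i ω)) ω hω
    have pZ : 0 < prob μ Z (Z ω) := prob_pos hμ0 _ ω hω
    have pK : 0 < prob μ K (K ω) := prob_pos hμ0 _ ω hω
    have pAU : ∀ i, 0 < prob μ (fun ω => (A i ω, U i ω)) (A i ω, U i ω) :=
      fun i => prob_pos hμ0 (fun ω => (A i ω, U i ω)) ω hω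
    have hupd : ∀ i (ω' : Ω), (A i ω' = A i ω ∧ V i ω' = V i ω) ↔ Z ω' = Z ω := by
      intro i ω'
      simp only [A, Z, Prod.ext_iff]
      constructor
      · rintro ⟨⟨h1, h2, h3⟩, h4⟩
        refine ⟨h1, h2, ?_⟩
        have := congrArg (fun f => Function.update f i (V i ω)) h3
        simp only [Function.update_idem] at this
        rw [Function.update_eq_self i (fun j => V j ω), ← h4,
          Function.update_eq_self i (fun j => V j ω')] at this
        exact this
      · rintro ⟨h1, h2, h3⟩
        exact ⟨⟨h1, h2, by rw [h3]⟩, congrFun h3 i⟩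
    have eAV : ∀ i, prob μ (fun ω => (A i ω, V i ω)) (A i ω, V i ω) = prob μ Z (Z ω) := fun i =>
      prob_congr _ _ _ _ _ fun ω' => by rw [← hupd i ω', Prod.ext_iff]
    have eUZ : ∀ i, prob μ (fun ω => (U i ω, Z ω)) (U i ω, Z ω) =
        prob μ (fun ω => (A i ω, U i ω)) (A i ω, U i ω) * (q (U i ω, V i ω) / prob μ (U i) (U i ω)) := by
      intro i
      rw [prob_U hq1 hiid i]
      refine Eq.trans ?_ (hmk i _ _ _)
      refine prob_congr _ _ _ _ _ fun ω' => ?_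
      have := hupd i ω'
      simp only [Prod.mk.injEq]
      rw [← this]
      tauto
    rw [prob_UKV hiid hKindep, prob_KV hiid hKindep]
    have eV : ∀ i, ∑ u, q (u, V i ω) = prob μ (V i) (V i ω) := fun i => (prob_V hq1 hiid i _).symm
    simp_rw [eV]
    have pKV : 0 < ∏ i, prob μ (V i) (V i ω) := Finset.prod_pos fun i _ => pV i
    have pKUV : 0 < ∏ i, q (U i ω, V i ω) := Finset.prod_pos fun i _ => pUV i
    have pUZ : ∀ i, 0 < prob μ (fun ω => (U i ω, Z ω)) (U i ω, Z ω) :=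
      fun i => prob_pos hμ0 (fun ω => (U i ω, Z ω)) ω hω
    have eL : ∀ i, Real.log (prob μ (fun ω => (U i ω, Z ω)) (U i ω, Z ω) / prob μ Z (Z ω)) =
        Real.log (prob μ (fun ω => (A i ω, U i ω)) (A i ω, U i ω)) +
          (Real.log (q (U i ω, V i ω)) - Real.log (prob μ (U i) (U i ω)))
          - Real.log (prob μ Z (Z ω)) := by
      intro i
      rw [Real.log_div (pUZ i).ne' pZ.ne', eUZ i,
        Real.log_mul (pAU i).ne' (div_pos (pUV i) (pU i)).ne', Real.log_div (pUV i).ne' (pU i).ne']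
    rw [Real.log_mul pZ.ne' (Finset.prod_pos fun i _ => div_pos (pUZ i) pZ).ne',
      Real.log_prod (fun i _ => (div_pos (pUZ i) pZ).ne'),
      Real.log_mul pK.ne' pKUV.ne', Real.log_mul pK.ne' pKV.ne',
      Real.log_prod (fun i _ => (pUV i).ne'), Real.log_prod (fun i _ => (pV i).ne')]
    simp only [eL, eAV, Finset.sum_add_distrib, Finset.sum_sub_distrib,
      Finset.sum_neg_distrib]
    ring
  have e : ∑ ω, μ ω * Real.log (prob μ Z (Z ω) *
        ∏ i, (prob μ (fun ω => (U i ω, Z ω)) (U i ω, Z ω) / prob μ Z (Z ω))) =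
      ∑ ω, (μ ω * Real.log (prob μ Z (Z ω))
        + μ ω * Real.log (prob μ (fun ω => ((fun i => U i ω), K ω, fun i => V i ω))
            ((fun i => U i ω), K ω, fun i => V i ω))
        - μ ω * Real.log (prob μ (fun ω => (K ω, fun i => V i ω)) (K ω, fun i => V i ω))
        + ∑ i, (-(μ ω * Real.log (prob μ (U i) (U i ω))) + μ ω * Real.log (prob μ (V i) (V i ω))
          - μ ω * Real.log (prob μ (fun ω => (A i ω, V i ω)) (A i ω, V i ω))
          + μ ω * Real.log (prob μ (fun ω => (A i ω, U i ω)) (A i ω, U i ω)))) := by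
    refine Finset.sum_congr rfl fun ω _ => ?_
    rcases (hμ0 ω).eq_or_lt with h0 | h0
    · simp [← h0]
    · rw [hpt ω h0, mul_add, Finset.mul_sum, mul_sub, mul_add]
      congr 1
      exact Finset.sum_congr rfl fun i _ => by ring
  simp only at G
  rw [e, Finset.sum_add_distrib, Finset.sum_sub_distrib, Finset.sum_add_distrib,
    Finset.sum_comm] at G
  have e2 : ∀ i, ∑ ω, (-(μ ω * Real.log (prob μ (U i) (U i ω))) + μ ω * Real.log (prob μ (V i) (V i ω))
          - μ ω * Real.log (prob μ (fun ω => (A i ω, V i ω)) (A i ω, V i ω))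
          + μ ω * Real.log (prob μ (fun ω => (A i ω, U i ω)) (A i ω, U i ω))) =
      entH μ (U i) - entH μ (V i) +
      (entH μ (fun ω => (A i ω, V i ω)) - entH μ (fun ω => (A i ω, U i ω))) := by
    intro i
    rw [Finset.sum_add_distrib, Finset.sum_sub_distrib, Finset.sum_add_distrib,
      Finset.sum_neg_distrib]
    simp only [entH_eq]
    ring
  simp_rw [e2] at G
  unfold condMI
  rw [entH_eq μ (fun ω => ((fun i => U i ω), K ω, fun i => V i ω)),
    entH_eq μ (fun ω => (Y ω, K ω, fun i => V i ω)),
    entH_eq μ (fun ω => ((fun i => U i ω), Y ω, K ω, fun i => V i ω)),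
    entH_eq μ (fun ω => (K ω, fun i => V i ω))]
  simp only [Z] at G
  linarith
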